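/- Fix integers p, q with 1 + |p| < |q| and gcd(p, q) = 1, and let t = x² + px − q ∈ ℤ[x]. Then the language L_η = { w ∈ Dom_{p,q} : there exists k ∈ ℤ with t ∣ (P(w) − kx) } is not a regular language. (Equivalently, the cyclic component ⟨η⟩ of ℤ², where η is the class of the polynomial x, is not FA-recognizable with respect to the Nies–Semukhin presentation ψ_{p,q}.) -/

import Mathlib

open Polynomial

/-- The alphabet `Σ_q`: integers of absolute value at most `|q| − 1`. -/
def NSAlph (q : ℤ) : Type := {a : ℤ // |a| < |q|}

/-- The polynomial `P(w) = a₀ + a₁x + ⋯ + a_nxⁿ` represented by the string `w = a₀a₁…a_n`. -/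
noncomputable def NSpoly {q : ℤ} : List (NSAlph q) → Polynomial ℤ
  | [] => 0
  | a :: w => C a.val + X * NSpoly w

/-- Two strings are equivalent if `t = X² + pX − q` divides the difference of the
polynomials they represent. -/
def NSequiv (p q : ℤ) (u v : List (NSAlph q)) : Prop :=
  (X ^ 2 + C p * X - C q) ∣ (NSpoly u - NSpoly v)

/-- The length-lexicographic order on strings over `Σ_q`. -/
def NSllex {q : ℤ} (u v : List (NSAlph q)) : Prop :=
  u.length < v.length ∨
    (u.length = v.length ∧ List.Lex (fun a b : NSAlph q => a.val < b.val) u v)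

/-- The domain of the Nies–Semukhin presentation `ψ_{p,q}`: strings that are
length-lexicographically minimal in their equivalence class. -/
def NSDom (p q : ℤ) : Language (NSAlph q) :=
  { w | ∀ u, NSllex u w → ¬ NSequiv p q u w }


theorem NSpoly_append {q : ℤ} (u v : List (NSAlph q)) :
    NSpoly (u ++ v) = NSpoly u + X ^ u.length * NSpoly v := by
  induction u with
  | nil => simp [NSpoly]
  | cons a u ih =>
    simp only [List.cons_append, NSpoly, ih, List.length_cons]
    ring

instance (q : ℤ) : Finite (NSAlph q) :=
  ((Set.finite_Ioo (-|q|) |q|).subset fun _ ha => abs_lt.mp ha).to_subtype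

theorem NSllex_wf (q : ℤ) : WellFounded (NSllex (q := q)) := by
  have : Std.Irrefl fun a b : NSAlph q => a.val < b.val := ⟨fun a => lt_irrefl a.val⟩
  have : IsTrans (NSAlph q) fun a b => a.val < b.val :=
    ⟨fun _ _ _ hab hbc => lt_trans hab hbc⟩
  have h := List.Shortlex.wf (Finite.wellFounded_of_trans_of_irrefl
    fun a b : NSAlph q => a.val < b.val)
  refine h.mono fun u v huv => List.shortlex_def.mpr huv

/-- Every equivalence class that has a representative has one in the domain. -/
theorem exists_mem_NSDom_equiv (p : ℤ) {q : ℤ} (u : List (NSAlph q)) :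
    ∃ w ∈ NSDom p q, NSequiv p q w u := by
  obtain ⟨w, hw, hmin⟩ := (NSllex_wf q).has_min {w | NSequiv p q w u}
    ⟨u, by simp [NSequiv]⟩
  refine ⟨w, fun v hv hvw => hmin v ?_ hv, hw⟩
  simpa [NSequiv] using dvd_add hvw hw

theorem length_le_of_NSequiv {p q : ℤ} {u w : List (NSAlph q)} (hw : w ∈ NSDom p q)
    (h : NSequiv p q u w) : w.length ≤ u.length := by
  by_contra! hlt
  exact hw u (Or.inl hlt) h

/-- Every residue class `b + cX` modulo `X² + pX − q` is represented by a string. -/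
theorem exists_NSpoly_dvd_sub {p q : ℤ} (hpq : 1 + |p| < |q|) (b c : ℤ) :
    ∃ w : List (NSAlph q), (X ^ 2 + C p * X - C q) ∣ NSpoly w - (C b + C c * X) := by
  induction hn : 2 * (b.natAbs + c.natAbs) + (if c = 0 then 0 else 1)
    using Nat.strong_induction_on generalizing b c with
  | _ n ih =>
    by_cases hbc : b = 0 ∧ c = 0
    · exact ⟨[], by simp [hbc.1, hbc.2, NSpoly]⟩
    have hq0 : q ≠ 0 := by rintro rfl; have := abs_nonneg p; simp at hpq; omega
    have hdiv : |q| * |b.tdiv q| ≤ |b| := by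
      simp only [Int.abs_eq_natAbs, Int.natAbs_tdiv]
      exact_mod_cast Nat.mul_div_le _ _
    have hrem : |b.tmod q| < |q| := by
      simp only [Int.abs_eq_natAbs, Int.natAbs_tmod]
      exact_mod_cast Nat.mod_lt _ (by omega)
    have hsplit := Int.mul_tdiv_add_tmod b q
    set m := b.tdiv q
    set r := b.tmod q
    have hnew : |c + m * p| + |m| ≤ |c| + |b| - |m| := by
      have h₁ := abs_add_le c (m * p)
      rw [abs_mul] at h₁
      nlinarith [abs_nonneg m]
    have hnew' : (c + m * p).natAbs + m.natAbs + m.natAbs ≤ c.natAbs + b.natAbs := by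
      zify
      linarith
    have hlt : 2 * ((c + m * p).natAbs + m.natAbs) + (if m = 0 then 0 else 1) < n := by
      by_cases hm : m = 0
      · have hr : b = r := by rw [← hsplit, hm]; ring
        simp only [hm] at *
        split_ifs at hn <;> simp_all <;> omega
      · split_ifs at hn ⊢ <;> omega
    obtain ⟨w, g, hg⟩ := ih _ hlt _ _ rfl
    refine ⟨⟨r, hrem⟩ :: w, X * g + C m, ?_⟩
    have hw : NSpoly w = (X ^ 2 + C p * X - C q) * g + (C (c + m * p) + C m * X) := by
      rw [← hg]; ring
    simp only [NSpoly, hw, ← hsplit, map_add, map_mul]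
    ring

theorem eq_zero_of_dvd_linear {p q b c : ℤ}
    (h : (X ^ 2 + C p * X - C q) ∣ (C b + C c * X : ℤ[X])) : b = 0 ∧ c = 0 := by
  have hmonic : (X ^ 2 + C p * X - C q : ℤ[X]).Monic := by monicity!
  have hdeg : (X ^ 2 + C p * X - C q : ℤ[X]).natDegree = 2 := by compute_degree!
  have hlt : (C b + C c * X : ℤ[X]).natDegree < (X ^ 2 + C p * X - C q : ℤ[X]).natDegree := by
    rw [hdeg]
    exact lt_of_le_of_lt (b := 1) (by compute_degree) one_lt_two
  have h0 : (C b + C c * X : ℤ[X]) = 0 := by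
    by_contra hne
    exact hmonic.not_dvd_of_natDegree_lt hne hlt h
  constructor
  · simpa using congrArg (coeff · 0) h0
  · simpa [coeff_C, -eq_intCast] using congrArg (coeff · 1) h0

theorem dvd_of_dvd_X_mul {p q : ℤ} (hq : q ≠ 0) {f : ℤ[X]}
    (h : (X ^ 2 + C p * X - C q) ∣ X * f) : (X ^ 2 + C p * X - C q) ∣ f := by
  obtain ⟨g, hg⟩ := h
  have h0 : g.coeff 0 = 0 := by
    simpa [mul_coeff_zero, hq] using congrArg (coeff · 0) hg
  obtain ⟨k, rfl⟩ := X_dvd_iff.mpr h0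
  exact ⟨k, mul_left_cancel₀ X_ne_zero (by rw [hg]; ring)⟩

/-- The coefficient of `X` in the reduction of a positive power of `X` modulo `X² + pX − q`
is coprime to `q`. -/
theorem exists_X_pow_equiv_linear {p q : ℤ} (hgcd : IsCoprime p q) (l : ℕ) :
    ∃ b c : ℤ, IsCoprime c q ∧
      (X ^ 2 + C p * X - C q) ∣ (X ^ (l + 1) - (C (q * b) + C c * X) : ℤ[X]) := by
  induction l with
  | zero => exact ⟨0, 1, isCoprime_one_left, by simp⟩
  | succ l ih =>
    obtain ⟨b, c, hc, g, hg⟩ := ih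
    refine ⟨c, q * b - c * p, ?_, X * g + C c, ?_⟩
    · rw [show q * b - c * p = -(c * p) + q * b by ring]
      exact (hc.mul_left hgcd).neg_left.add_mul_left_left b
    · have hX : (X ^ (l + 1) : ℤ[X]) =
          (X ^ 2 + C p * X - C q) * g + (C (q * b) + C c * X) := by
        rw [← hg]; ring
      rw [pow_succ, hX]
      simp only [map_sub, map_mul]
      ring

/-- Modulo `X² + pX − q`, multiplying a nonzero integer multiple of `X` by a positive power
of `X` never gives an integer multiple of `X`. -/
theorem eq_zero_of_X_pow_mul_equiv {p q : ℤ} (hgcd : IsCoprime p q) (hq : 1 < |q|)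
    {l : ℕ} (hl : l ≠ 0) {d e : ℤ}
    (h : (X ^ 2 + C p * X - C q) ∣ (X ^ l * (C d * X) - C e * X : ℤ[X])) : d = 0 := by
  have hq0 : q ≠ 0 := by rintro rfl; simp at hq
  obtain ⟨l, rfl⟩ := Nat.exists_eq_succ_of_ne_zero hl
  obtain ⟨b, c, hc, hbc⟩ := exists_X_pow_equiv_linear hgcd l
  have h₁ : (X ^ 2 + C p * X - C q) ∣ (X ^ (l + 1) * C d - C e : ℤ[X]) :=
    dvd_of_dvd_X_mul hq0 (by convert h using 1; rw [Nat.succ_eq_add_one]; ring)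
  have h₂ := dvd_sub h₁ (hbc.mul_right (C d))
  have h₃ : c * d = 0 := by
    refine (eq_zero_of_dvd_linear (p := p) (q := q) (b := q * b * d - e) ?_).2
    convert h₂ using 1
    simp only [map_sub, map_mul]
    ring
  refine (mul_eq_zero.mp h₃).resolve_left fun hc0 => ?_
  rw [hc0, isCoprime_zero_left, Int.isUnit_iff_abs_eq] at hc
  omega

/-- The language of domain strings representing multiples of `η` is infinite. -/
theorem infinite_L_eta {p q : ℤ} (hpq : 1 + |p| < |q|) :
    {w ∈ NSDom p q | ∃ k : ℤ, (X ^ 2 + C p * X - C q) ∣ (NSpoly w - C k * X)}.Infinite := by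
  have hex (k : ℤ) : ∃ w ∈ NSDom p q, (X ^ 2 + C p * X - C q) ∣ (NSpoly w - C k * X) := by
    obtain ⟨u, hu⟩ := exists_NSpoly_dvd_sub hpq 0 k
    obtain ⟨w, hw, hwu⟩ := exists_mem_NSDom_equiv p u
    exact ⟨w, hw, by simpa using dvd_add hwu hu⟩
  choose f hf hfk using hex
  refine Set.infinite_of_injective_forall_mem (f := f) (fun j k hjk => ?_)
    fun k => ⟨hf k, k, hfk k⟩
  have h := dvd_sub (hfk k) (hjk ▸ hfk j)
  have h' := (eq_zero_of_dvd_linear (p := p) (q := q) (b := 0) (c := j - k) (by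
    convert h using 1
    simp only [map_sub, map_zero]
    ring)).2
  omega

/-- A string cannot be pumped inside the language of domain strings representing multiples
of `η`. -/
theorem eq_nil_of_pumpable {p q : ℤ} (hq : 1 < |q|) (hgcd : IsCoprime p q)
    {u v w : List (NSAlph q)} (h₁ : u ++ v ++ w ∈ NSDom p q)
    (hk₀ : ∃ k : ℤ, (X ^ 2 + C p * X - C q) ∣ (NSpoly (u ++ w) - C k * X))
    (hk₁ : ∃ k : ℤ, (X ^ 2 + C p * X - C q) ∣ (NSpoly (u ++ v ++ w) - C k * X))
    (hk₂ : ∃ k : ℤ, (X ^ 2 + C p * X - C q) ∣ (NSpoly (u ++ (v ++ v) ++ w) - C k * X)) :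
    v = [] := by
  by_contra hv
  obtain ⟨k₀, hk₀⟩ := hk₀
  obtain ⟨k₁, hk₁⟩ := hk₁
  obtain ⟨k₂, hk₂⟩ := hk₂
  have hd : k₁ - k₀ = 0 := by
    refine eq_zero_of_X_pow_mul_equiv (e := k₂ - k₁) hgcd hq (mt List.length_eq_zero_iff.mp hv) ?_
    have h := dvd_sub (dvd_sub hk₂ hk₁) ((dvd_sub hk₁ hk₀).mul_left (X ^ v.length))
    convert h using 1
    simp only [NSpoly_append, List.length_append, map_sub]
    ring
  obtain rfl : k₁ = k₀ := by omega
  have hlen := length_le_of_NSequiv (u := u ++ w) h₁ (by simpa [NSequiv] using dvd_sub hk₀ hk₁)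
  have := List.length_pos_iff.mpr hv
  simp only [List.length_append] at hlen
  omega

/-- Nies–Semukhin: for `1 + |p| < |q|` and `gcd(p,q) = 1`, the language of strings in
`Dom_{p,q}` representing elements of the cyclic subgroup `⟨η⟩` generated by the class of
the polynomial `x` is not regular. -/
theorem L_eta_not_regular (p q : ℤ) (hpq : 1 + |p| < |q|) (hgcd : Int.gcd p q = 1) :
    ¬ Language.IsRegular
      { w ∈ NSDom p q | ∃ k : ℤ, (X ^ 2 + C p * X - C q) ∣ (NSpoly w - C k * X) } := by
  rintro ⟨σ, _, M, hM⟩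
  have hq : 1 < |q| := by have := abs_nonneg p; omega
  obtain ⟨x, hx, hlen⟩ : ∃ x ∈ M.accepts, Fintype.card σ ≤ x.length := by
    by_contra! h
    refine infinite_L_eta hpq ((List.finite_length_lt (NSAlph q) (Fintype.card σ)).subset ?_)
    exact fun x hx => h x (hM ▸ hx)
  obtain ⟨u, v, w, -, -, hv, hsub⟩ := M.pumping_lemma hx hlen
  rw [hM] at hsub
  have hmem (y) (hy : y ∈ KStar.kstar ({v} : Language (NSAlph q))) := hsub
    (Language.append_mem_mul (Language.append_mem_mul (Set.mem_singleton u) hy)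
      (Set.mem_singleton w))
  have h₀ := hmem [] (Language.nil_mem_kstar _)
  have hvv : v ∈ ({v} : Language (NSAlph q)) := Set.mem_singleton v
  have h₁ := hmem v (Language.mem_kstar.mpr ⟨[v], by simp, by simpa using hvv⟩)
  have h₂ := hmem (v ++ v) (Language.mem_kstar.mpr ⟨[v, v], by simp, by simpa using hvv⟩)
  rw [List.append_nil] at h₀
  exact hv (eq_nil_of_pumpable hq (Int.isCoprime_iff_gcd_eq_one.mpr hgcd) h₁.1 h₀.2 h₁.2 h₂.2)
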